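/- There exist absolute constants C_T ≥ 1 and C_d ≥ 1 such that the following holds. Let M ∈ ℝ^{m×n} be a rank-r μ-incoherent matrix with singular values Σmax ≥ Σmin > 0 and set β_T = √(C_T·r·Σmax). Suppose X ∈ ℝ^{m×r}, Y ∈ ℝ^{n×r} satisfy ‖X‖_F ≤ β_T, ‖Y‖_F ≤ β_T and d := ‖X·Yᵀ − M‖_F ≤ Σmin/(C_d·r). Then there exist U ∈ ℝ^{m×r} and V ∈ ℝ^{n×r} such that: (a) U·Vᵀ = M; (b) ‖U − X‖_F·‖V − Y‖_F ≤ 25·√r·(β_T²/Σmin²)·d²; (c) ‖U^{(i)}‖² ≤ (3/2)·(rμ/m)·β_T² for every row i and ‖V^{(j)}‖² ≤ (3/2)·(rμ/n)·β_T² for every row j; (d) if ‖X‖_F > √(2/3)·β_T then ‖U‖_F ≤ ‖X‖_F, and if ‖Y‖_F > √(2/3)·β_T then ‖V‖_F ≤ ‖Y‖_F. -/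

import Mathlib

open Matrix
open scoped Classical

noncomputable section

/-- Frobenius norm of a real matrix. -/
def frob {m n : ℕ} (A : Matrix (Fin m) (Fin n) ℝ) : ℝ :=
  Real.sqrt (∑ i, ∑ j, A i j ^ 2)

/-- Euclidean norm of the `i`-th row of a matrix. -/
def rowNorm {m n : ℕ} (A : Matrix (Fin m) (Fin n) ℝ) (i : Fin m) : ℝ :=
  Real.sqrt (∑ j, A i j ^ 2)

/-- Frobenius inner product `⟨A,B⟩ = trace(AᵀB)`. -/
def finner {m n : ℕ} (A B : Matrix (Fin m) (Fin n) ℝ) : ℝ :=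
  ∑ i, ∑ j, A i j * B i j

/-- Projection onto the set of entries indexed by `Ω` (other entries are set to `0`). -/
def projOmega {m n : ℕ} (Ω : Finset (Fin m × Fin n)) (A : Matrix (Fin m) (Fin n) ℝ) :
    Matrix (Fin m) (Fin n) ℝ :=
  Matrix.of fun i j => if (i, j) ∈ Ω then A i j else 0

/-- `G₀(z) = (max{0, z-1})²`. -/
def G0 (z : ℝ) : ℝ := max 0 (z - 1) ^ 2

/-- `G₀′(z) = 2·max{0, z-1}`. -/
def G0' (z : ℝ) : ℝ := 2 * max 0 (z - 1)

/-- The matrix whose `i`-th row is the `i`-th row of `A` and whose other rows vanish. -/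
def rowMat {m n : ℕ} (A : Matrix (Fin m) (Fin n) ℝ) (i : Fin m) :
    Matrix (Fin m) (Fin n) ℝ :=
  Matrix.of fun i' j => if i' = i then A i j else 0

/-- The regularizer `G(X,Y)`. -/
def Greg {m n r : ℕ} (ρ β1 β2 βT : ℝ) (X : Matrix (Fin m) (Fin r) ℝ)
    (Y : Matrix (Fin n) (Fin r) ℝ) : ℝ :=
  ρ * ∑ i, G0 (3 * rowNorm X i ^ 2 / (2 * β1 ^ 2)) +
    ρ * ∑ j, G0 (3 * rowNorm Y j ^ 2 / (2 * β2 ^ 2)) +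
    ρ * G0 (3 * frob X ^ 2 / (2 * βT ^ 2)) +
    ρ * G0 (3 * frob Y ^ 2 / (2 * βT ^ 2))

/-- The regularized objective `F̃(X,Y)`. -/
def Ftilde {m n r : ℕ} (Ω : Finset (Fin m × Fin n)) (M : Matrix (Fin m) (Fin n) ℝ)
    (ρ β1 β2 βT : ℝ) (X : Matrix (Fin m) (Fin r) ℝ) (Y : Matrix (Fin n) (Fin r) ℝ) : ℝ :=
  (1 / 2) * frob (projOmega Ω (M - X * Yᵀ)) ^ 2 + Greg ρ β1 β2 βT X Y

/-- Gradient of the regularizer with respect to one of the factors. -/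
def gradG1 {m r : ℕ} (ρ β βT : ℝ) (X : Matrix (Fin m) (Fin r) ℝ) :
    Matrix (Fin m) (Fin r) ℝ :=
  (∑ i, (ρ * G0' (3 * rowNorm X i ^ 2 / (2 * β ^ 2)) * (3 / β ^ 2)) • rowMat X i) +
    (ρ * G0' (3 * frob X ^ 2 / (2 * βT ^ 2)) * (3 / βT ^ 2)) • X

/-- `∇_X F̃(X,Y)`. -/
def gradX {m n r : ℕ} (Ω : Finset (Fin m × Fin n)) (M : Matrix (Fin m) (Fin n) ℝ)
    (ρ β1 βT : ℝ) (X : Matrix (Fin m) (Fin r) ℝ) (Y : Matrix (Fin n) (Fin r) ℝ) :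
    Matrix (Fin m) (Fin r) ℝ :=
  projOmega Ω (X * Yᵀ - M) * Y + gradG1 ρ β1 βT X

/-- `∇_Y F̃(X,Y)`. -/
def gradY {m n r : ℕ} (Ω : Finset (Fin m × Fin n)) (M : Matrix (Fin m) (Fin n) ℝ)
    (ρ β2 βT : ℝ) (X : Matrix (Fin m) (Fin r) ℝ) (Y : Matrix (Fin n) (Fin r) ℝ) :
    Matrix (Fin n) (Fin r) ℝ :=
  (projOmega Ω (X * Yᵀ - M))ᵀ * X + gradG1 ρ β2 βT Y

/-- Membership in `K₁`. -/
def K1mem {m n r : ℕ} (β1 β2 : ℝ) (X : Matrix (Fin m) (Fin r) ℝ)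
    (Y : Matrix (Fin n) (Fin r) ℝ) : Prop :=
  (∀ i, rowNorm X i ≤ β1) ∧ ∀ j, rowNorm Y j ≤ β2

/-- Membership in `K₂`. -/
def K2mem {m n r : ℕ} (βT : ℝ) (X : Matrix (Fin m) (Fin r) ℝ)
    (Y : Matrix (Fin n) (Fin r) ℝ) : Prop :=
  frob X ≤ βT ∧ frob Y ≤ βT

/-- Membership in `K(t) = {(X,Y) : ‖M - XYᵀ‖_F ≤ t}`. -/
def Kmem {m n r : ℕ} (M : Matrix (Fin m) (Fin n) ℝ) (t : ℝ)
    (X : Matrix (Fin m) (Fin r) ℝ) (Y : Matrix (Fin n) (Fin r) ℝ) : Prop :=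
  frob (M - X * Yᵀ) ≤ t

theorem hle_of_sq {a b : ℝ} (h : a ^ 2 ≤ b ^ 2) (hb : 0 ≤ b) : a ≤ b :=
  abs_le_of_sq_le_sq' h hb |>.2

section frobnorm
attribute [local instance] Matrix.frobeniusNormedAddCommGroup Matrix.frobeniusNormedSpace

theorem frob_eq_norm {m n : ℕ} (A : Matrix (Fin m) (Fin n) ℝ) : frob A = ‖A‖ := by
  rw [Matrix.frobenius_norm_def, frob, Real.sqrt_eq_rpow]
  simp [sq_abs]

theorem frob_nonneg {m n : ℕ} (A : Matrix (Fin m) (Fin n) ℝ) : 0 ≤ frob A := Real.sqrt_nonneg _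

theorem frob_add_le {m n : ℕ} (A B : Matrix (Fin m) (Fin n) ℝ) :
    frob (A + B) ≤ frob A + frob B := by
  simp only [frob_eq_norm]; exact norm_add_le _ _

theorem frob_neg {m n : ℕ} (A : Matrix (Fin m) (Fin n) ℝ) : frob (-A) = frob A := by
  simp only [frob_eq_norm]; exact norm_neg _

theorem frob_mul_le {m n p : ℕ} (A : Matrix (Fin m) (Fin n) ℝ) (B : Matrix (Fin n) (Fin p) ℝ) :
    frob (A * B) ≤ frob A * frob B := by
  simp only [frob_eq_norm]; exact Matrix.frobenius_norm_mul _ _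

theorem frob_transpose {m n : ℕ} (A : Matrix (Fin m) (Fin n) ℝ) : frob Aᵀ = frob A := by
  simp only [frob_eq_norm]; exact Matrix.frobenius_norm_transpose _

theorem frob_eq_zero {m n : ℕ} (A : Matrix (Fin m) (Fin n) ℝ) (h : frob A = 0) : A = 0 := by
  rw [frob_eq_norm] at h; exact norm_eq_zero.1 h

end frobnorm

theorem frob_sq {m n : ℕ} (A : Matrix (Fin m) (Fin n) ℝ) :
    frob A ^ 2 = ∑ i, ∑ j, A i j ^ 2 :=
  Real.sq_sqrt (Finset.sum_nonneg fun _ _ => Finset.sum_nonneg fun _ _ => sq_nonneg _)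

theorem rowNorm_sq {m n : ℕ} (A : Matrix (Fin m) (Fin n) ℝ) (i : Fin m) :
    rowNorm A i ^ 2 = ∑ j, A i j ^ 2 :=
  Real.sq_sqrt (Finset.sum_nonneg fun _ _ => sq_nonneg _)

theorem frob_sq_trace {m n : ℕ} (A : Matrix (Fin m) (Fin n) ℝ) :
    frob A ^ 2 = (A * Aᵀ).trace := by
  rw [frob_sq]
  simp [Matrix.trace, Matrix.mul_apply, sq]

theorem frob_pyth {p n r : ℕ} (A : Matrix (Fin p) (Fin n) ℝ) (Q : Matrix (Fin n) (Fin r) ℝ)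
    (hQ : Qᵀ * Q = 1) :
    frob A ^ 2 = frob (A * Q) ^ 2 + frob (A - A * Q * Qᵀ) ^ 2 := by
  have h : (A - A * Q * Qᵀ) * (A - A * Q * Qᵀ)ᵀ = A * Aᵀ - A * Q * (A * Q)ᵀ := by
    have e : A * Q * Qᵀ * (Q * (Qᵀ * Aᵀ)) = A * Q * (Qᵀ * Aᵀ) := by
      calc _ = A * Q * ((Qᵀ * Q) * (Qᵀ * Aᵀ)) := by simp only [Matrix.mul_assoc]
        _ = _ := by rw [hQ, Matrix.one_mul]
    simp only [Matrix.transpose_sub, Matrix.transpose_mul, Matrix.transpose_transpose,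
      Matrix.sub_mul, Matrix.mul_sub, e]
    simp only [Matrix.mul_assoc]
    abel
  rw [frob_sq_trace, frob_sq_trace, frob_sq_trace, h, Matrix.trace_sub]; ring

theorem frob_mul_orth_le {p n r : ℕ} (A : Matrix (Fin p) (Fin n) ℝ)
    (Q : Matrix (Fin n) (Fin r) ℝ) (hQ : Qᵀ * Q = 1) : frob (A * Q) ≤ frob A := by
  refine hle_of_sq ?_ (frob_nonneg _)
  rw [frob_pyth A Q hQ]; nlinarith [sq_nonneg (frob (A - A * Q * Qᵀ))]

theorem frob_sub_proj_le {p n r : ℕ} (A : Matrix (Fin p) (Fin n) ℝ)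
    (Q : Matrix (Fin n) (Fin r) ℝ) (hQ : Qᵀ * Q = 1) : frob (A - A * Q * Qᵀ) ≤ frob A := by
  refine hle_of_sq ?_ (frob_nonneg _)
  rw [frob_pyth A Q hQ]; nlinarith [sq_nonneg (frob (A * Q))]

theorem frob_orthT_mul_le {p n r : ℕ} (A : Matrix (Fin n) (Fin p) ℝ)
    (Q : Matrix (Fin n) (Fin r) ℝ) (hQ : Qᵀ * Q = 1) : frob (Qᵀ * A) ≤ frob A := by
  rw [← frob_transpose, ← frob_transpose A, Matrix.transpose_mul, Matrix.transpose_transpose]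
  exact frob_mul_orth_le _ _ hQ

/-- multiplication by a matrix with orthonormal columns on the left is isometric -/
theorem frob_orth_mul {p n r : ℕ} (A : Matrix (Fin r) (Fin p) ℝ)
    (Q : Matrix (Fin n) (Fin r) ℝ) (hQ : Qᵀ * Q = 1) : frob (Q * A) = frob A := by
  have : frob (Q * A) ^ 2 = frob A ^ 2 := by
    rw [← frob_transpose, ← frob_transpose A, frob_sq_trace, frob_sq_trace]
    congr 1
    simp only [Matrix.transpose_mul, Matrix.transpose_transpose]
    calc _ = Aᵀ * (Qᵀ * Q) * A := by simp only [Matrix.mul_assoc]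
      _ = _ := by rw [hQ, Matrix.mul_one]
  exact (sq_eq_sq₀ (frob_nonneg _) (frob_nonneg _)).1 this

theorem frob_mul_diag_sq {p r : ℕ} (A : Matrix (Fin p) (Fin r) ℝ) (T : Fin r → ℝ) :
    frob (A * diagonal T) ^ 2 = ∑ k, T k ^ 2 * ∑ i, A i k ^ 2 := by
  rw [frob_sq, Finset.sum_comm]
  simp only [Matrix.mul_diagonal, Finset.mul_sum]
  refine Finset.sum_congr rfl fun k _ => Finset.sum_congr rfl fun i _ => by ring

theorem frob_sq_cols {p r : ℕ} (A : Matrix (Fin p) (Fin r) ℝ) :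
    frob A ^ 2 = ∑ k, ∑ i, A i k ^ 2 := by
  rw [frob_sq, Finset.sum_comm]

theorem col_nonneg {p r : ℕ} (A : Matrix (Fin p) (Fin r) ℝ) (k : Fin r) :
    0 ≤ ∑ i, A i k ^ 2 := Finset.sum_nonneg fun _ _ => sq_nonneg _

theorem frob_mul_diag_ge {p r : ℕ} (A : Matrix (Fin p) (Fin r) ℝ) (σ : Fin r → ℝ) (s : ℝ)
    (hs : 0 ≤ s) (h : ∀ k, s ≤ σ k) : s * frob A ≤ frob (A * diagonal σ) := by
  refine hle_of_sq ?_ (frob_nonneg _)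
  rw [frob_mul_diag_sq, mul_pow, frob_sq_cols, Finset.mul_sum]
  refine Finset.sum_le_sum fun k _ => ?_
  exact mul_le_mul_of_nonneg_right (pow_le_pow_left₀ hs (h k) 2) (col_nonneg A k)

theorem frob_mul_diag_le {p r : ℕ} (A : Matrix (Fin p) (Fin r) ℝ) (σ : Fin r → ℝ) (s : ℝ)
    (hs : 0 ≤ s) (h : ∀ k, |σ k| ≤ s) : frob (A * diagonal σ) ≤ s * frob A := by
  refine hle_of_sq ?_ (mul_nonneg hs (frob_nonneg _))
  rw [frob_mul_diag_sq, mul_pow, frob_sq_cols, Finset.mul_sum]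
  refine Finset.sum_le_sum fun k _ => ?_
  refine mul_le_mul_of_nonneg_right ?_ (col_nonneg A k)
  rw [← sq_abs]
  exact pow_le_pow_left₀ (abs_nonneg _) (h k) 2

theorem inv_lemma {r : ℕ} (N : Matrix (Fin r) (Fin r) ℝ) (σ : Fin r → ℝ) (s d : ℝ)
    (hd : frob (N - diagonal σ) ≤ d) (hds : d < s) (h : ∀ k, s ≤ σ k) (p : ℕ)
    (C : Matrix (Fin p) (Fin r) ℝ) : (s - d) * frob C ≤ frob (C * N) := by
  have hd0 : 0 ≤ d := (frob_nonneg _).trans hd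
  have h1 := frob_mul_diag_ge C σ s (by linarith) h
  have h2 : frob (C * diagonal σ) ≤ frob (C * N) + frob (C * (N - diagonal σ)) := by
    have : C * diagonal σ = C * N + -(C * (N - diagonal σ)) := by
      rw [Matrix.mul_sub]; abel
    rw [this]
    exact (frob_add_le _ _).trans (by rw [frob_neg])
  have h3 := frob_mul_le C (N - diagonal σ)
  have h4 := mul_le_mul_of_nonneg_left hd (frob_nonneg C)
  nlinarith

theorem inv_det {r : ℕ} (N : Matrix (Fin r) (Fin r) ℝ) (c : ℝ) (hc : 0 < c)
    (h : ∀ C : Matrix (Fin 1) (Fin r) ℝ, c * frob C ≤ frob (C * N)) : IsUnit N.det := by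
  rw [← Matrix.isUnit_iff_isUnit_det, ← Matrix.vecMul_injective_iff_isUnit]
  rw [← Matrix.coe_vecMulLinear, ← LinearMap.ker_eq_bot, LinearMap.ker_eq_bot']
  intro v hv
  have h1 := h (Matrix.of fun _ j => v j)
  have h2 : (Matrix.of fun (_ : Fin 1) j => v j) * N = 0 := by
    ext i j
    have := congrFun hv j
    simpa [Matrix.mul_apply, Matrix.vecMul, dotProduct] using this
  have h3 : frob (0 : Matrix (Fin 1) (Fin r) ℝ) = 0 := by simp [frob]
  rw [h2, h3] at h1
  have h4 : frob (Matrix.of fun (_ : Fin 1) j => v j) = 0 := by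
    nlinarith [frob_nonneg (Matrix.of fun (_ : Fin 1) j => v j)]
  have h5 := frob_eq_zero _ h4
  ext j
  exact congrFun (congrFun h5 0) j

/-- base construction -/
theorem base_lemma {m n r : ℕ} (s d β : ℝ)
    (M : Matrix (Fin m) (Fin n) ℝ) (Uh : Matrix (Fin m) (Fin r) ℝ) (Vh : Matrix (Fin n) (Fin r) ℝ)
    (σ : Fin r → ℝ) (hU : Uhᵀ * Uh = 1) (hV : Vhᵀ * Vh = 1)
    (hM : M = Uh * diagonal σ * Vhᵀ) (hσ : ∀ k, s ≤ σ k)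
    (X : Matrix (Fin m) (Fin r) ℝ) (Y : Matrix (Fin n) (Fin r) ℝ)
    (hX : frob X ≤ β) (hY : frob Y ≤ β) (hd : frob (X * Yᵀ - M) = d) (hds : d < s) :
    ∃ (P Q : Matrix (Fin r) (Fin r) ℝ), (Uh * P) * (Vh * Q)ᵀ = M ∧
      (s - d) * frob (Uh * P - X) ≤ d * β ∧ (s - d) * frob (Vh * Q - Y) ≤ d * β := by
  obtain ⟨X1, hX1⟩ : ∃ X1, X1 = Uhᵀ * X := ⟨_, rfl⟩
  obtain ⟨Y1, hY1⟩ : ∃ Y1, Y1 = Vhᵀ * Y := ⟨_, rfl⟩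
  obtain ⟨N, hN⟩ : ∃ N, N = X1 * Y1ᵀ := ⟨_, rfl⟩
  have hMV : M * Vh = Uh * diagonal σ := by
    rw [hM, Matrix.mul_assoc, hV, Matrix.mul_one]
  have hUM : Uhᵀ * M = diagonal σ * Vhᵀ := by
    rw [hM, Matrix.mul_assoc, ← Matrix.mul_assoc, hU, Matrix.one_mul]
  have hNd : frob (N - diagonal σ) ≤ d := by
    have : N - diagonal σ = Uhᵀ * ((X * Yᵀ - M) * Vh) := by
      rw [Matrix.sub_mul, Matrix.mul_sub, hMV, ← Matrix.mul_assoc Uhᵀ Uh, hU, Matrix.one_mul, hN, hX1, hY1]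
      simp only [Matrix.transpose_mul, Matrix.transpose_transpose, Matrix.mul_assoc]
    rw [this, ← hd]
    exact (frob_orthT_mul_le _ _ hU).trans (frob_mul_orth_le _ _ hV)
  have hNT : frob (Nᵀ - diagonal σ) ≤ d := by
    rw [← frob_transpose]; simpa using hNd
  have b1 := fun p => inv_lemma N σ s d hNd hds hσ p
  have b2 := fun p => inv_lemma Nᵀ σ s d hNT hds hσ p
  have hdet := inv_det N (s - d) (by linarith) (b1 1)
  have hd0 : 0 ≤ d := hd ▸ frob_nonneg _
  have hX1b : frob X1 ≤ β := by rw [hX1]; exact (frob_orthT_mul_le _ _ hU).trans hX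
  have hY1b : frob Y1 ≤ β := by rw [hY1]; exact (frob_orthT_mul_le _ _ hV).trans hY
  have e1 : Y1ᵀ * N⁻¹ * X1 = 1 := by
    rw [mul_eq_one_comm, ← Matrix.mul_assoc, ← hN]
    exact Matrix.mul_nonsing_inv _ hdet
  have e2 : X1ᵀ * N⁻¹ᵀ * Y1 = 1 := by
    have := congrArg Matrix.transpose e1
    simpa [Matrix.transpose_mul, Matrix.mul_assoc] using this
  refine ⟨diagonal σ * N⁻¹ * X1, Y1, ?_, ?_, ?_⟩
  · calc _ = Uh * diagonal σ * (N⁻¹ * (X1 * Y1ᵀ)) * Vhᵀ := by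
          simp only [Matrix.transpose_mul, Matrix.mul_assoc]
      _ = M := by rw [← hN, Matrix.nonsing_inv_mul _ hdet, Matrix.mul_one, hM]
  · obtain ⟨C, hC⟩ : ∃ C, C = -((X * Yᵀ - M) * Vh) * N⁻¹ := ⟨_, rfl⟩
    have h1 : Uh * (diagonal σ * N⁻¹ * X1) - X = C * X1 := by
      have e3 : X = X * (Y1ᵀ * N⁻¹ * X1) := by rw [e1, Matrix.mul_one]
      rw [hC, Matrix.sub_mul, hMV]
      conv_lhs => rw [e3]
      rw [hY1]
      simp only [Matrix.transpose_mul, Matrix.transpose_transpose, Matrix.mul_assoc,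
        Matrix.sub_mul, Matrix.neg_mul]
      abel
    have h2 : (s - d) * frob C ≤ d := by
      refine (b1 _ C).trans ?_
      rw [hC, Matrix.mul_assoc, Matrix.nonsing_inv_mul _ hdet, Matrix.mul_one, frob_neg, ← hd]
      exact frob_mul_orth_le _ _ hV
    rw [h1]
    calc (s - d) * frob (C * X1) ≤ (s - d) * (frob C * frob X1) :=
          mul_le_mul_of_nonneg_left (frob_mul_le _ _) (by linarith)
      _ = ((s - d) * frob C) * frob X1 := by ring
      _ ≤ d * β := mul_le_mul h2 hX1b (frob_nonneg _) hd0
  · obtain ⟨W, hW⟩ : ∃ W, W = Uhᵀ * (X * Yᵀ - M) := ⟨_, rfl⟩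
    obtain ⟨C, hC⟩ : ∃ C, C = -(W - W * Vh * Vhᵀ)ᵀ * N⁻¹ᵀ := ⟨_, rfl⟩
    have hW1 : W - W * Vh * Vhᵀ = X1 * Yᵀ - X1 * Y1ᵀ * Vhᵀ := by
      have e5 : diagonal σ * Vhᵀ * Vh * Vhᵀ = diagonal σ * Vhᵀ := by
        rw [Matrix.mul_assoc _ Vhᵀ Vh, hV, Matrix.mul_one]
      rw [hW, Matrix.mul_sub, hUM, Matrix.sub_mul, Matrix.sub_mul, e5, hX1, hY1]
      simp only [Matrix.transpose_mul, Matrix.transpose_transpose, Matrix.mul_assoc]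
      abel
    have h1 : Vh * Y1 - Y = C * Y1 := by
      have e3 : Y = Y * (X1ᵀ * N⁻¹ᵀ * Y1) := by rw [e2, Matrix.mul_one]
      have e4 : Vh * Y1 = Vh * Y1 * (X1ᵀ * N⁻¹ᵀ * Y1) := by rw [e2, Matrix.mul_one]
      rw [hC, hW1, e4]
      conv_lhs => rw [e3]
      simp only [Matrix.transpose_mul, Matrix.transpose_transpose, Matrix.mul_assoc,
        Matrix.sub_mul, Matrix.neg_mul, Matrix.transpose_sub]
      abel
    have h2 : (s - d) * frob C ≤ d := by
      refine (b2 _ C).trans ?_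
      rw [hC, Matrix.mul_assoc, ← Matrix.transpose_mul, Matrix.mul_nonsing_inv _ hdet,
        Matrix.transpose_one, Matrix.mul_one, frob_neg, frob_transpose, ← hd]
      refine (frob_sub_proj_le _ _ hV).trans ?_
      rw [hW]
      exact frob_orthT_mul_le _ _ hU
    rw [h1]
    calc (s - d) * frob (C * Y1) ≤ (s - d) * (frob C * frob Y1) :=
          mul_le_mul_of_nonneg_left (frob_mul_le _ _) (by linarith)
      _ = ((s - d) * frob C) * frob Y1 := by ring
      _ ≤ d * β := mul_le_mul h2 hY1b (frob_nonneg _) hd0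

theorem spec_lemma {m r : ℕ} (A : Matrix (Fin m) (Fin r) ℝ) :
    ∃ (B : Matrix (Fin r) (Fin r) ℝ) (e : Fin r → ℝ), Bᵀ * B = 1 ∧ B * Bᵀ = 1 ∧
      (A * B)ᵀ * (A * B) = diagonal e := by
  have hH : (Aᵀ * A).IsHermitian := by
    have := Matrix.isHermitian_conjTranspose_mul_self A
    rwa [Matrix.conjTranspose_eq_transpose_of_trivial] at this
  have hB : (hH.eigenvectorUnitary : Matrix (Fin r) (Fin r) ℝ)ᵀ * hH.eigenvectorUnitary = 1 := by
    have := Unitary.coe_star_mul_self hH.eigenvectorUnitary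
    rwa [Matrix.star_eq_conjTranspose, Matrix.conjTranspose_eq_transpose_of_trivial] at this
  obtain ⟨B, hBdef⟩ : ∃ B, B = (hH.eigenvectorUnitary : Matrix (Fin r) (Fin r) ℝ) := ⟨_, rfl⟩
  have hs := hH.spectral_theorem
  rw [Unitary.conjStarAlgAut_apply, Matrix.star_eq_conjTranspose,
    Matrix.conjTranspose_eq_transpose_of_trivial] at hs
  rw [← hBdef] at hB hs
  refine ⟨B, hH.eigenvalues, hB, mul_eq_one_comm.1 hB, ?_⟩
  calc (A * B)ᵀ * (A * B) = Bᵀ * (Aᵀ * A) * B := by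
        simp only [Matrix.transpose_mul, Matrix.mul_assoc]
    _ = (Bᵀ * B) * diagonal hH.eigenvalues * (Bᵀ * B) := by
        conv_lhs => rw [hs]
        simp only [Matrix.mul_assoc]
        rfl
    _ = _ := by rw [hB, Matrix.one_mul, Matrix.mul_one]

theorem scale_lemma {p r : ℕ} (A : Matrix (Fin p) (Fin r) ℝ) (T : Fin r → ℝ) (t S : ℝ)
    (ht : 0 < t) (ht1 : t ≤ 1)
    (h : ∀ k, T k = t ∨ (T k = t⁻¹ ∧ ∑ i, A i k ^ 2 ≤ S)) (hS : 0 ≤ S) :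
    frob (A * diagonal T) ^ 2 ≤ t ^ 2 * frob A ^ 2 + (t⁻¹ ^ 2 - t ^ 2) * (r * S) ∧
    frob (A * diagonal T - A) ≤ (t⁻¹ - 1) * frob A := by
  have hti : 1 ≤ t⁻¹ := (one_le_inv₀ ht).2 ht1
  have hq : 0 ≤ t⁻¹ ^ 2 - t ^ 2 := by nlinarith
  constructor
  · rw [frob_mul_diag_sq, frob_sq_cols]
    have : (t⁻¹ ^ 2 - t ^ 2) * (r * S) = ∑ k : Fin r, (t⁻¹ ^ 2 - t ^ 2) * S := by
      simp; ring
    rw [this, Finset.mul_sum, ← Finset.sum_add_distrib]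
    refine Finset.sum_le_sum fun k _ => ?_
    rcases h k with h1 | ⟨h1, h2⟩
    · rw [h1]; nlinarith [mul_nonneg hq hS]
    · rw [h1]; nlinarith [mul_le_mul_of_nonneg_left h2 hq]
  · have : A * diagonal T - A = A * diagonal (fun k => T k - 1) := by
      ext i k; simp [Matrix.mul_diagonal]; ring
    rw [this]
    refine frob_mul_diag_le _ _ _ (by linarith) fun k => ?_
    have h3 : 1 - t ≤ t⁻¹ - 1 := by
      have : t * t⁻¹ = 1 := mul_inv_cancel₀ ht.ne'
      nlinarith [sq_nonneg (t - t⁻¹), sq_nonneg (t - 1), sq_nonneg (t⁻¹ - 1)]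
    rcases h k with h1 | ⟨h1, h2⟩
    · rw [h1, abs_le]; constructor <;> linarith
    · rw [h1, abs_le]; constructor <;> linarith

/-- rebalancing -/
theorem balance_lemma {m n r : ℕ} (S t : ℝ) (hS : 0 < S) (ht : 0 < t) (ht1 : t ≤ 1)
    (M : Matrix (Fin m) (Fin n) ℝ) (Uh : Matrix (Fin m) (Fin r) ℝ) (Vh : Matrix (Fin n) (Fin r) ℝ)
    (σ : Fin r → ℝ) (hU : Uhᵀ * Uh = 1) (hV : Vhᵀ * Vh = 1)
    (hM : M = Uh * diagonal σ * Vhᵀ) (hσ : ∀ k, |σ k| ≤ S)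
    (U0 : Matrix (Fin m) (Fin r) ℝ) (V0 : Matrix (Fin n) (Fin r) ℝ) (hUV : U0 * V0ᵀ = M) :
    ∃ K L : Matrix (Fin r) (Fin r) ℝ, (U0 * K) * (V0 * L)ᵀ = M ∧
      frob (U0 * K) ^ 2 ≤ t ^ 2 * frob U0 ^ 2 + (t⁻¹ ^ 2 - t ^ 2) * (r * S) ∧
      frob (U0 * K - U0) ≤ (t⁻¹ - 1) * frob U0 ∧
      frob (V0 * L) ^ 2 ≤ t ^ 2 * frob V0 ^ 2 + (t⁻¹ ^ 2 - t ^ 2) * (r * S) ∧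
      frob (V0 * L - V0) ≤ (t⁻¹ - 1) * frob V0 := by
  obtain ⟨B, e, hB1, hB2, he⟩ := spec_lemma U0
  obtain ⟨Ub, hUb⟩ : ∃ Ub, Ub = U0 * B := ⟨_, rfl⟩
  obtain ⟨Vb, hVb⟩ : ∃ Vb, Vb = V0 * B := ⟨_, rfl⟩
  rw [← hUb] at he
  have hMT : ∀ A : Matrix (Fin m) (Fin 1) ℝ, frob (Mᵀ * A) ≤ S * frob A := by
    intro A
    have h1 : Mᵀ * A = Vh * ((Aᵀ * Uh) * diagonal σ)ᵀ := by
      rw [hM]; simp [Matrix.transpose_mul, Matrix.mul_assoc]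
    rw [h1, frob_orth_mul _ _ hV, frob_transpose]
    refine (frob_mul_diag_le _ _ S hS.le hσ).trans ?_
    refine mul_le_mul_of_nonneg_left ?_ hS.le
    rw [← frob_transpose A]
    exact frob_mul_orth_le _ _ hU
  have hcol : ∀ k, ∑ i, Ub i k ^ 2 = e k := by
    intro k
    have := congrFun (congrFun he k) k
    simpa [Matrix.mul_apply, sq] using this
  have hVd : Vb * diagonal e = Mᵀ * Ub := by
    rw [← he, ← hUV, hVb]
    have : V0 * B * (Ubᵀ * Ub) = V0 * (B * Bᵀ) * U0ᵀ * Ub := by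
      rw [hUb]; simp only [Matrix.transpose_mul, Matrix.mul_assoc]
    rw [this, hB2, Matrix.mul_one, Matrix.transpose_mul, Matrix.transpose_transpose]
  have hvcol : ∀ k, S ≤ e k → ∑ i, Vb i k ^ 2 ≤ S := by
    intro k hk
    have h1 := hMT (Matrix.of fun i _ => Ub i k)
    have h2 : frob (Matrix.of fun i (_ : Fin 1) => Ub i k) ^ 2 = e k := by
      rw [frob_sq, ← hcol]; simp
    have h3 : frob (Mᵀ * Matrix.of fun i (_ : Fin 1) => Ub i k) ^ 2
        = e k ^ 2 * ∑ i, Vb i k ^ 2 := by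
      rw [frob_sq, Finset.mul_sum]
      refine Finset.sum_congr rfl fun i _ => ?_
      have h4 := congrFun (congrFun hVd i) k
      rw [Matrix.mul_diagonal] at h4
      have h5 : (Mᵀ * Matrix.of fun i (_ : Fin 1) => Ub i k) i 0 = (Mᵀ * Ub) i k := by
        simp [Matrix.mul_apply]
      simp only [Finset.univ_unique, Fin.default_eq_zero, Finset.sum_singleton]
      rw [h5, ← h4]; ring
    have h6 := pow_le_pow_left₀ (frob_nonneg _) h1 2
    rw [h3, mul_pow, h2] at h6
    have hek : 0 < e k := hS.trans_le hk
    have h7 : e k * ∑ i, Vb i k ^ 2 ≤ S ^ 2 := by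
      refine le_of_mul_le_mul_left ?_ hek
      nlinarith
    refine le_of_mul_le_mul_left ?_ hek
    nlinarith
  obtain ⟨T, hT⟩ : ∃ T : Fin r → ℝ, T = fun k => if S ≤ e k then t else t⁻¹ := ⟨_, rfl⟩
  obtain ⟨T', hT'⟩ : ∃ T' : Fin r → ℝ, T' = fun k => if S ≤ e k then t⁻¹ else t := ⟨_, rfl⟩
  have hTT : diagonal T * (diagonal T')ᵀ = 1 := by
    rw [Matrix.diagonal_transpose, Matrix.diagonal_mul_diagonal, ← Matrix.diagonal_one]
    congr 1; ext k; rw [hT, hT']; dsimp only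
    split_ifs
    · exact mul_inv_cancel₀ ht.ne'
    · exact inv_mul_cancel₀ ht.ne'
  have s1 := scale_lemma Ub T t S ht ht1 (fun k => by
    rw [hT]; dsimp only
    split_ifs with h
    · left; rfl
    · right; exact ⟨rfl, by rw [hcol]; linarith⟩) hS.le
  have s2 := scale_lemma Vb T' t S ht ht1 (fun k => by
    rw [hT']; dsimp only
    split_ifs with h
    · right; exact ⟨rfl, hvcol k h⟩
    · left; rfl) hS.le
  have hBi : ∀ {p : ℕ} (A : Matrix (Fin p) (Fin r) ℝ), frob (A * Bᵀ) = frob A := by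
    intro p A
    rw [← frob_transpose, Matrix.transpose_mul, Matrix.transpose_transpose,
      frob_orth_mul _ _ hB1, frob_transpose]
  have hU0 : U0 = Ub * Bᵀ := by rw [hUb, Matrix.mul_assoc, hB2, Matrix.mul_one]
  have hV0 : V0 = Vb * Bᵀ := by rw [hVb, Matrix.mul_assoc, hB2, Matrix.mul_one]
  have hUK : U0 * (B * diagonal T * Bᵀ) = Ub * diagonal T * Bᵀ := by
    rw [hUb]; simp only [Matrix.mul_assoc]
  have hVL : V0 * (B * diagonal T' * Bᵀ) = Vb * diagonal T' * Bᵀ := by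
    rw [hVb]; simp only [Matrix.mul_assoc]
  have nU : frob U0 = frob Ub := by rw [hU0, hBi]
  have nV : frob V0 = frob Vb := by rw [hV0, hBi]
  refine ⟨B * diagonal T * Bᵀ, B * diagonal T' * Bᵀ, ?_, ?_, ?_, ?_, ?_⟩
  · rw [hUK, hVL]
    calc _ = Ub * (diagonal T * ((Bᵀ * B) * (diagonal T')ᵀ)) * Vbᵀ := by
          simp only [Matrix.transpose_mul, Matrix.transpose_transpose, Matrix.mul_assoc]
      _ = Ub * Vbᵀ := by rw [hB1, Matrix.one_mul, hTT, Matrix.mul_one]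
      _ = U0 * (B * Bᵀ) * V0ᵀ := by
          rw [hUb, hVb]; simp only [Matrix.transpose_mul, Matrix.mul_assoc]
      _ = M := by rw [hB2, Matrix.mul_one, hUV]
  · rw [hUK, hBi, nU]; exact s1.1
  · rw [hUK, nU]
    conv_lhs => rw [hU0, ← Matrix.sub_mul, hBi]
    exact s1.2
  · rw [hVL, hBi, nV]; exact s2.1
  · rw [hVL, nV]
    conv_lhs => rw [hV0, ← Matrix.sub_mul, hBi]
    exact s2.2

theorem row_lemma {m r : ℕ} (Uh : Matrix (Fin m) (Fin r) ℝ) (hU : Uhᵀ * Uh = 1)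
    (P : Matrix (Fin r) (Fin r) ℝ) (i : Fin m) :
    rowNorm (Uh * P) i ^ 2 ≤ (∑ k, Uh i k ^ 2) * frob (Uh * P) ^ 2 := by
  rw [frob_orth_mul _ _ hU, rowNorm_sq, frob_sq_cols, Finset.mul_sum]
  refine Finset.sum_le_sum fun j _ => ?_
  rw [Matrix.mul_apply]
  exact Finset.sum_mul_sq_le_sq_mul_sq _ _ _

/-- scalar estimates for one factor -/
theorem scalar_lemma (β ε x u w δ z R : ℝ) (hβ : 0 ≤ β) (hε : 0 ≤ ε) (hε1 : ε ≤ 1 / 100)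
    (hx : x ≤ β) (hx0 : 0 ≤ x) (hu0 : 0 ≤ u) (hw0 : 0 ≤ w)
    (hδ : (1 - ε) * δ ≤ ε * β) (hux : u ≤ x + δ)
    (hR : 100 * R = β ^ 2)
    (hw : w ^ 2 ≤ (1 - 3 * ε) ^ 2 * u ^ 2 + ((1 - 3 * ε)⁻¹ ^ 2 - (1 - 3 * ε) ^ 2) * R)
    (hz : z ≤ ((1 - 3 * ε)⁻¹ - 1) * u + δ) :
    z ≤ 5 * ε * β ∧ (Real.sqrt (2 / 3) * β < x → w ≤ x) := by
  have hδ1 : δ ≤ 1.1 * ε * β := by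
    have hεβ := mul_nonneg hε hβ
    by_contra hc
    push Not at hc
    nlinarith
  have ht : 0 < 1 - 3 * ε := by linarith
  have hi : (1 - 3 * ε)⁻¹ ≤ 1 + 3.1 * ε := by
    rw [inv_le_iff_one_le_mul₀ ht]; nlinarith
  have hi0 : 0 < (1 - 3 * ε)⁻¹ := inv_pos.2 ht
  have hεβ := mul_nonneg hε hβ
  constructor
  · have h1 : u ≤ 1.02 * β := by nlinarith
    have h2 : ((1 - 3 * ε)⁻¹ - 1) * u ≤ (3.1 * ε) * (1.02 * β) :=
      mul_le_mul (by linarith) h1 hu0 (by linarith)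
    nlinarith
  · intro hb
    have hb2 : β ^ 2 ≤ 1.5 * x ^ 2 := by
      have h1 : (Real.sqrt (2 / 3) * β) ^ 2 ≤ x ^ 2 :=
        pow_le_pow_left₀ (mul_nonneg (Real.sqrt_nonneg _) hβ) hb.le 2
      rw [mul_pow, Real.sq_sqrt (by norm_num)] at h1
      linarith
    have hβx : β ≤ 1.23 * x := by
      refine hle_of_sq ?_ (by linarith)
      nlinarith
    have h3 : u ≤ (1 + 1.36 * ε) * x := by
      nlinarith [mul_le_mul_of_nonneg_left hβx hε, mul_nonneg hε hx0]
    have h4 : (1 - 3 * ε) * u ≤ (1 - 1.6 * ε) * x := by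
      have : (1 - 3 * ε) * u ≤ (1 - 3 * ε) * ((1 + 1.36 * ε) * x) :=
        mul_le_mul_of_nonneg_left h3 ht.le
      nlinarith [mul_nonneg hε hx0, mul_nonneg hε (mul_nonneg hε hx0)]
    have h5 : (1 - 3 * ε) ^ 2 * u ^ 2 ≤ (1 - 1.6 * ε) ^ 2 * x ^ 2 := by
      rw [← mul_pow, ← mul_pow]
      exact pow_le_pow_left₀ (mul_nonneg ht.le hu0) h4 2
    have h6 : (1 - 3 * ε)⁻¹ ^ 2 - (1 - 3 * ε) ^ 2 ≤ 15 * ε := by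
      have := pow_le_pow_left₀ hi0.le hi 2
      nlinarith
    have hR0 : 0 ≤ R := by nlinarith [sq_nonneg β]
    have h7 := mul_le_mul_of_nonneg_right h6 hR0
    have h8 : (15 * ε) * R ≤ (15 * ε) * (0.015 * x ^ 2) :=
      mul_le_mul_of_nonneg_left (by nlinarith) (by linarith)
    refine hle_of_sq ?_ hx0
    have h9 : (1 - 1.6 * ε) ^ 2 ≤ 1 - 1.6 * ε := by nlinarith
    have h10 := mul_le_mul_of_nonneg_right h9 (sq_nonneg x)
    have h11 := mul_nonneg hε (sq_nonneg x)
    linarith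

/-- **Corollary: summary of the choice of U, V.** -/
theorem stmt7 :
    ∃ CT Cd : ℝ, 1 ≤ CT ∧ 1 ≤ Cd ∧
      ∀ (m n r : ℕ), 1 ≤ m → 1 ≤ n → 1 ≤ r →
      ∀ (μ Smax Smin : ℝ)
        (M : Matrix (Fin m) (Fin n) ℝ)
        (Uh : Matrix (Fin m) (Fin r) ℝ) (Vh : Matrix (Fin n) (Fin r) ℝ)
        (σ : Fin r → ℝ),
        Uhᵀ * Uh = 1 → Vhᵀ * Vh = 1 →
        (∀ k, 0 < σ k) → (∀ k l : Fin r, k ≤ l → σ l ≤ σ k) →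
        M = Uh * Matrix.diagonal σ * Vhᵀ →
        ((∀ k, σ k ≤ Smax) ∧ ∃ k, σ k = Smax) →
        ((∀ k, Smin ≤ σ k) ∧ ∃ k, σ k = Smin) →
        (∀ i, ∑ k, Uh i k ^ 2 ≤ μ * r / m) →
        (∀ j, ∑ k, Vh j k ^ 2 ≤ μ * r / n) →
        ∀ (X : Matrix (Fin m) (Fin r) ℝ) (Y : Matrix (Fin n) (Fin r) ℝ),
          frob X ≤ Real.sqrt (CT * r * Smax) →
          frob Y ≤ Real.sqrt (CT * r * Smax) →
          frob (X * Yᵀ - M) ≤ Smin / (Cd * r) →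
          ∃ (U : Matrix (Fin m) (Fin r) ℝ) (V : Matrix (Fin n) (Fin r) ℝ),
            U * Vᵀ = M ∧
            frob (U - X) * frob (V - Y) ≤
              25 * Real.sqrt r * (Real.sqrt (CT * r * Smax) ^ 2 / Smin ^ 2) *
                frob (X * Yᵀ - M) ^ 2 ∧
            (∀ i, rowNorm U i ^ 2 ≤ 3 / 2 * (r * μ / m) * Real.sqrt (CT * r * Smax) ^ 2) ∧
            (∀ j, rowNorm V j ^ 2 ≤ 3 / 2 * (r * μ / n) * Real.sqrt (CT * r * Smax) ^ 2) ∧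
            (frob X > Real.sqrt (2 / 3) * Real.sqrt (CT * r * Smax) → frob U ≤ frob X) ∧
            (frob Y > Real.sqrt (2 / 3) * Real.sqrt (CT * r * Smax) → frob V ≤ frob Y) := by
  refine ⟨100, 100, by norm_num, by norm_num, ?_⟩
  intro m n r hm hn hr μ S s M Uh Vh σ hU hV hσ0 _ hM hSm hsm hμU hμV X Y hX hY hd
  obtain ⟨hSle, k0, hk0⟩ := hSm
  obtain ⟨hsle, k1, hk1⟩ := hsm
  have hS : 0 < S := hk0 ▸ hσ0 k0
  have hs : 0 < s := hk1 ▸ hσ0 k1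
  have hr1 : (1 : ℝ) ≤ r := by exact_mod_cast hr
  have hm1 : (1 : ℝ) ≤ m := by exact_mod_cast hm
  have hn1 : (1 : ℝ) ≤ n := by exact_mod_cast hn
  obtain ⟨β, hβ⟩ : ∃ β, β = Real.sqrt (100 * r * S) := ⟨_, rfl⟩
  obtain ⟨d, hdd⟩ : ∃ d, frob (X * Yᵀ - M) = d := ⟨_, rfl⟩
  rw [← hβ] at hX hY ⊢
  rw [hdd] at hd ⊢
  have hβ0 : 0 ≤ β := hβ ▸ Real.sqrt_nonneg _
  have hR : 100 * (r * S) = β ^ 2 := by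
    rw [hβ, Real.sq_sqrt (by positivity)]; ring
  have hd0 : 0 ≤ d := hdd ▸ frob_nonneg _
  obtain ⟨ε, hε⟩ : ∃ ε, ε = d / s := ⟨_, rfl⟩
  have hdε : d = ε * s := by rw [hε]; field_simp
  have hε0 : 0 ≤ ε := by rw [hε]; positivity
  have hε1 : ε ≤ 1 / 100 := by
    rw [hε, div_le_iff₀ hs]
    refine hd.trans ?_
    rw [div_le_iff₀ (by positivity)]
    nlinarith
  have hds : d < s := by nlinarith
  obtain ⟨P, Q, hPQ, b1, b2⟩ := base_lemma s d β M Uh Vh σ hU hV hM hsle X Y hX hY hdd hds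
  have ht : 0 < 1 - 3 * ε := by linarith
  obtain ⟨K, L, hKL, c1, c2, c3, c4⟩ := balance_lemma S (1 - 3 * ε) hS ht (by linarith) M Uh Vh σ
    hU hV hM (fun k => by rw [abs_of_pos (hσ0 k)]; exact hSle k) (Uh * P) (Vh * Q) hPQ
  have tri : ∀ {p : ℕ} (A B C : Matrix (Fin p) (Fin r) ℝ),
      frob (A - C) ≤ frob (A - B) + frob (B - C) := by
    intro p A B C
    have := frob_add_le (A - B) (B - C)
    rwa [sub_add_sub_cancel] at this
  have tri2 : ∀ {p : ℕ} (A B : Matrix (Fin p) (Fin r) ℝ),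
      frob A ≤ frob B + frob (A - B) := by
    intro p A B
    have := frob_add_le B (A - B)
    rwa [add_sub_cancel] at this
  have bb : ∀ f : ℝ, (s - d) * f ≤ d * β → (1 - ε) * f ≤ ε * β := by
    intro f hf
    refine le_of_mul_le_mul_left ?_ hs
    rw [hdε] at hf
    linarith
  obtain ⟨z1, w1⟩ := scalar_lemma β ε (frob X) (frob (Uh * P)) (frob (Uh * P * K))
    (frob (Uh * P - X)) (frob (Uh * P * K - X)) (r * S) hβ0 hε0 hε1 hX (frob_nonneg _)
    (frob_nonneg _) (frob_nonneg _) (bb _ b1) (tri2 _ _) hR c1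
    ((tri _ (Uh * P) _).trans (by linarith))
  obtain ⟨z2, w2⟩ := scalar_lemma β ε (frob Y) (frob (Vh * Q)) (frob (Vh * Q * L))
    (frob (Vh * Q - Y)) (frob (Vh * Q * L - Y)) (r * S) hβ0 hε0 hε1 hY (frob_nonneg _)
    (frob_nonneg _) (frob_nonneg _) (bb _ b2) (tri2 _ _) hR c3
    ((tri _ (Vh * Q) _).trans (by linarith))
  have big : ∀ a x z : ℝ, 0 ≤ a → a ≤ x + z → x ≤ β → z ≤ 5 * ε * β → a ^ 2 ≤ 3 / 2 * β ^ 2 := by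
    intro a x z ha h1 h2 h3
    have h5 := mul_le_mul_of_nonneg_right hε1 hβ0
    have h4 : a ≤ 1.05 * β := by linarith
    have := pow_le_pow_left₀ ha h4 2
    nlinarith [sq_nonneg β]
  have n1 := big _ _ _ (frob_nonneg _) (tri2 (Uh * P * K) X) hX z1
  have n2 := big _ _ _ (frob_nonneg _) (tri2 (Vh * Q * L) Y) hY z2
  refine ⟨Uh * P * K, Vh * Q * L, hKL, ?_, ?_, ?_, w1, w2⟩
  · have h1 : frob (Uh * P * K - X) * frob (Vh * Q * L - Y) ≤ (5 * ε * β) * (5 * ε * β) :=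
      mul_le_mul z1 z2 (frob_nonneg _) (by positivity)
    have h2 : (5 * ε * β) * (5 * ε * β) = 25 * 1 * (β ^ 2 / s ^ 2) * d ^ 2 := by
      rw [hε]; field_simp; ring
    rw [h2] at h1
    refine h1.trans ?_
    have h3 : 1 ≤ Real.sqrt r := Real.one_le_sqrt.2 hr1
    gcongr
  · intro i
    have h1 := row_lemma Uh hU (P * K) i
    rw [← Matrix.mul_assoc] at h1
    have h0 : 0 ≤ ∑ k, Uh i k ^ 2 := Finset.sum_nonneg fun _ _ => sq_nonneg _
    have h2 := mul_le_mul (hμU i) n1 (sq_nonneg _) (h0.trans (hμU i))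
    calc _ ≤ _ := h1.trans h2
      _ = _ := by ring
  · intro j
    have h1 := row_lemma Vh hV (Q * L) j
    rw [← Matrix.mul_assoc] at h1
    have h0 : 0 ≤ ∑ k, Vh j k ^ 2 := Finset.sum_nonneg fun _ _ => sq_nonneg _
    have h2 := mul_le_mul (hμV j) n2 (sq_nonneg _) (h0.trans (hμV j))
    calc _ ≤ _ := h1.trans h2
      _ = _ := by ring

end
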